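/- Let Φ_{s,N}(α) := 2^{2s} ( Γ((α+2s)/2)Γ((N−α)/2) / (Γ((N−α−2s)/2)Γ(α/2)) − Γ((N+2s)/4)²/Γ((N−2s)/4)² ) and Ψ_{s,N}(α) := Λ_{N,s} + Φ_{s,N}(α) for α ∈ [0, (N−2s)/2], with the convention Ψ_{s,N}(0) = 0. Then Ψ_{s,N} : [0, (N−2s)/2] → [0, Λ_{N,s}] is strictly increasing and surjective; in particular, for every θ ∈ (0, Λ_{N,s}) there exists a unique α_θ ∈ (0, (N−2s)/2) with Ψ_{s,N}(α_θ) = θ. -/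

import Mathlib

open MeasureTheory Real

noncomputable section

def Lam (N : ℕ) (s : ℝ) : ℝ :=
  2 ^ (2 * s) * Real.Gamma (((N : ℝ) + 2 * s) / 4) ^ 2 /
    Real.Gamma (((N : ℝ) - 2 * s) / 4) ^ 2

def Phi (N : ℕ) (s α : ℝ) : ℝ :=
  2 ^ (2 * s) *
    (Real.Gamma ((α + 2 * s) / 2) * Real.Gamma (((N : ℝ) - α) / 2) /
        (Real.Gamma (((N : ℝ) - α - 2 * s) / 2) * Real.Gamma (α / 2)) -
      Real.Gamma (((N : ℝ) + 2 * s) / 4) ^ 2 / Real.Gamma (((N : ℝ) - 2 * s) / 4) ^ 2)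

/-- `Ψ_{s,N}(α) = Λ_{N,s} + Φ_{s,N}(α)`, with the convention `Ψ_{s,N}(0) = 0`. -/
def Psi (N : ℕ) (s α : ℝ) : ℝ :=
  if α = 0 then 0 else Lam N s + Phi N s α

end


/-- The quotient `Γ(x+s)/Γ(x)`. -/
noncomputable def gq (s x : ℝ) : ℝ := Real.Gamma (x + s) / Real.Gamma x

theorem gq_pos {s x : ℝ} (hs : 0 < s) (hx : 0 < x) : 0 < gq s x :=
  div_pos (Real.Gamma_pos_of_pos (by linarith)) (Real.Gamma_pos_of_pos hx)

theorem gq_zero (s : ℝ) : gq s 0 = 0 := by simp [gq, Real.Gamma_zero]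

theorem gq_eq {s x : ℝ} (hx : 0 ≤ x) :
    gq s x = Real.Gamma (x + s) * x / Real.Gamma (x + 1) := by
  rcases hx.eq_or_lt with h | h
  · rw [← h, gq_zero]; simp
  · have := (Real.Gamma_pos_of_pos h).ne'
    rw [gq, Real.Gamma_add_one h.ne']
    field_simp

theorem gq_succ {s x : ℝ} (hs : 0 < s) (hx : 0 < x) :
    gq s x = x / (x + s) * gq s (x + 1) := by
  have h1 : x + s ≠ 0 := by linarith
  have := (Real.Gamma_pos_of_pos hx).ne'
  rw [gq, gq, Real.Gamma_add_one hx.ne', show x + 1 + s = (x + s) + 1 by ring,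
    Real.Gamma_add_one h1]
  field_simp

theorem gq_cont {s : ℝ} (hs : 0 < s) : ContinuousOn (gq s) (Set.Ici 0) := by
  have h : ContinuousOn (fun x : ℝ => Real.Gamma (x + s) * x / Real.Gamma (x + 1))
      (Set.Ici 0) := by
    have key : ∀ t : ℝ, 0 < t → ContinuousOn (fun x : ℝ => Real.Gamma (x + t)) (Set.Ici 0) := by
      intro t ht x hx
      have hx' : (0 : ℝ) ≤ x := hx
      have h1 : ContinuousAt Real.Gamma (x + t) :=
        (Real.differentiableAt_Gamma (fun m => by
          have : (0 : ℝ) ≤ m := Nat.cast_nonneg m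
          intro h; linarith)).continuousAt
      exact (ContinuousAt.comp (f := fun x : ℝ => x + t) h1 (by fun_prop)).continuousWithinAt
    refine ((key s hs).mul continuousOn_id).div (key 1 one_pos) ?_
    intro x hx
    have hx' : (0 : ℝ) ≤ x := hx
    exact (Real.Gamma_pos_of_pos (by linarith)).ne'
  exact h.congr fun x hx => gq_eq hx

/-- Finite approximation of `gq s x * gq s y`. -/
theorem gq_seq {s x y : ℝ} (hs : 0 < s) (hx : 0 < x) (hy : 0 < y) {n : ℕ} (hn : 0 < n) :
    Real.GammaSeq (x + s) n * Real.GammaSeq (y + s) n /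
      (Real.GammaSeq x n * Real.GammaSeq y n) =
    (n : ℝ) ^ (2 * s) * ∏ j ∈ Finset.range (n + 1),
      ((x + j) * (y + j) / ((x + s + j) * (y + s + j))) := by
  have hn' : (0 : ℝ) < n := by exact_mod_cast hn
  have hp : ∀ z : ℝ, 0 < z → (∏ j ∈ Finset.range (n + 1), (z + (j : ℝ))) ≠ 0 := by
    intro z hz
    exact (Finset.prod_pos fun j _ => by positivity).ne'
  have h1 := hp x hx
  have h2 := hp y hy
  have h3 := hp (x + s) (by linarith)
  have h4 := hp (y + s) (by linarith)
  have hf : ((n.factorial : ℕ) : ℝ) ≠ 0 := by exact_mod_cast n.factorial_ne_zero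
  have hr : ∀ z : ℝ, (n : ℝ) ^ z ≠ 0 := fun z => (Real.rpow_pos_of_pos hn' z).ne'
  have e1 := hr x
  have e2 := hr y
  have e3 := hr s
  simp only [Real.GammaSeq, Finset.prod_div_distrib, Finset.prod_mul_distrib]
  rw [Real.rpow_add hn', Real.rpow_add hn', two_mul, Real.rpow_add hn']
  field_simp

theorem gq_weak {s x y x' y' : ℝ} (hs : 0 < s) (hx : 0 < x) (hy : 0 < y) (hx' : 0 < x')
    (hy' : 0 < y') (hsum : x + y = x' + y') (hprod : x * y ≤ x' * y') :
    gq s x * gq s y ≤ gq s x' * gq s y' := by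
  have lim : ∀ u v : ℝ, 0 < u → 0 < v → Filter.Tendsto (fun n : ℕ =>
      Real.GammaSeq (u + s) n * Real.GammaSeq (v + s) n /
      (Real.GammaSeq u n * Real.GammaSeq v n)) Filter.atTop (nhds (gq s u * gq s v)) := by
    intro u v hu hv
    rw [gq, gq, div_mul_div_comm]
    exact ((Real.GammaSeq_tendsto_Gamma _).mul (Real.GammaSeq_tendsto_Gamma _)).div
      ((Real.GammaSeq_tendsto_Gamma _).mul (Real.GammaSeq_tendsto_Gamma _))
      (mul_pos (Real.Gamma_pos_of_pos hu) (Real.Gamma_pos_of_pos hv)).ne'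
  refine le_of_tendsto_of_tendsto (lim x y hx hy) (lim x' y' hx' hy') ?_
  filter_upwards [Filter.eventually_gt_atTop 0] with n hn
  rw [gq_seq hs hx hy hn, gq_seq hs hx' hy' hn]
  refine mul_le_mul_of_nonneg_left ?_ (by positivity)
  refine Finset.prod_le_prod (fun j _ => by positivity) fun j _ => ?_
  have hj : (0 : ℝ) ≤ j := Nat.cast_nonneg j
  rw [div_le_div_iff₀ (by positivity) (by positivity)]
  have hd : 0 ≤ s * (x + y + 2 * j) + s ^ 2 := by positivity
  have hy2 : y' = x + y - x' := by linarith
  subst hy2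
  nlinarith [mul_le_mul_of_nonneg_left hprod hd]

theorem gq_strict {s x y x' y' : ℝ} (hs : 0 < s) (hx : 0 < x) (hy : 0 < y) (hx' : 0 < x')
    (hy' : 0 < y') (hsum : x + y = x' + y') (hprod : x * y < x' * y') :
    gq s x * gq s y < gq s x' * gq s y' := by
  have hw := gq_weak hs (x := x + 1) (y := y + 1) (x' := x' + 1) (y' := y' + 1)
    (by linarith) (by linarith) (by linarith) (by linarith) (by linarith) (by nlinarith)
  have hpos := mul_pos (gq_pos hs (x := x' + 1) (by linarith)) (gq_pos hs (x := y' + 1) (by linarith))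
  rw [gq_succ hs hx, gq_succ hs hy, gq_succ hs hx', gq_succ hs hy']
  have hlt : x / (x + s) * (y / (y + s)) < x' / (x' + s) * (y' / (y' + s)) := by
    rw [div_mul_div_comm, div_mul_div_comm, div_lt_div_iff₀ (by positivity) (by positivity)]
    have hd : 0 < s * (x + y) + s ^ 2 := by positivity
    have hy2 : y' = x + y - x' := by linarith
    subst hy2
    nlinarith [mul_lt_mul_of_pos_left hprod hd]
  have h0 : 0 < x / (x + s) * (y / (y + s)) := by positivity
  calc _ = (x / (x + s) * (y / (y + s))) * (gq s (x + 1) * gq s (y + 1)) := by ring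
    _ ≤ (x / (x + s) * (y / (y + s))) * (gq s (x' + 1) * gq s (y' + 1)) :=
        mul_le_mul_of_nonneg_left hw h0.le
    _ < (x' / (x' + s) * (y' / (y' + s))) * (gq s (x' + 1) * gq s (y' + 1)) :=
        mul_lt_mul_of_pos_right hlt hpos
    _ = _ := by ring

theorem Psi_eq (N : ℕ) (s α : ℝ) :
    Psi N s α = 2 ^ (2 * s) * (gq s (α / 2) * gq s (((N : ℝ) - α - 2 * s) / 2)) := by
  unfold Psi
  split_ifs with h
  · rw [h, zero_div, gq_zero]; ring
  · unfold Lam Phi gq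
    rw [show (α + 2 * s) / 2 = α / 2 + s by ring,
      show ((N : ℝ) - α) / 2 = ((N : ℝ) - α - 2 * s) / 2 + s by ring]
    rw [div_mul_div_comm, mul_comm (Real.Gamma (α / 2))]
    ring

theorem Lam_eq (N : ℕ) (s : ℝ) : Psi N s (((N : ℝ) - 2 * s) / 2) = Lam N s := by
  rw [Psi_eq]
  unfold Lam gq
  rw [show ((N : ℝ) - ((N : ℝ) - 2 * s) / 2 - 2 * s) / 2 = ((N : ℝ) - 2 * s) / 4 by ring,
    show ((N : ℝ) - 2 * s) / 2 / 2 = ((N : ℝ) - 2 * s) / 4 by ring,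
    show ((N : ℝ) - 2 * s) / 4 + s = ((N : ℝ) + 2 * s) / 4 by ring]
  ring

/-- `Ψ_{s,N} : [0,(N-2s)/2] → [0,Λ_{N,s}]` is strictly increasing and
surjective; in particular every `θ ∈ (0,Λ_{N,s})` has a unique preimage
`α_θ ∈ (0,(N-2s)/2)`. -/
theorem Psi_strictMono_surjective (N : ℕ) (s : ℝ) (hs : 0 < s) (hs1 : s < 1)
    (hN : 2 * s < (N : ℝ)) :
    Set.MapsTo (Psi N s) (Set.Icc 0 (((N : ℝ) - 2 * s) / 2)) (Set.Icc 0 (Lam N s)) ∧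
    StrictMonoOn (Psi N s) (Set.Icc 0 (((N : ℝ) - 2 * s) / 2)) ∧
    Set.SurjOn (Psi N s) (Set.Icc 0 (((N : ℝ) - 2 * s) / 2)) (Set.Icc 0 (Lam N s)) ∧
    ∀ θ : ℝ, 0 < θ → θ < Lam N s →
      ∃! α : ℝ, α ∈ Set.Ioo 0 (((N : ℝ) - 2 * s) / 2) ∧ Psi N s α = θ := by
  have hc : 0 < ((N : ℝ) - 2 * s) / 2 := by linarith
  have h0 : Psi N s 0 = 0 := by simp [Psi]
  have hL := Lam_eq N s
  have h2 : (0 : ℝ) < 2 ^ (2 * s) := by positivity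
  have hmono : StrictMonoOn (Psi N s) (Set.Icc 0 (((N : ℝ) - 2 * s) / 2)) := by
    intro a ha b hb hab
    obtain ⟨ha0, ha1⟩ := ha
    obtain ⟨hb0, hb1⟩ := hb
    rw [Psi_eq, Psi_eq]
    refine mul_lt_mul_of_pos_left ?_ h2
    rcases ha0.eq_or_lt with h | h
    · rw [← h, zero_div, gq_zero, zero_mul]
      exact mul_pos (gq_pos hs (by linarith)) (gq_pos hs (by linarith))
    · refine gq_strict hs (by linarith) (by linarith) (by linarith) (by linarith) (by ring) ?_
      nlinarith [mul_pos (sub_pos.2 hab) (show 0 < (N : ℝ) - 2 * s - a - b by linarith)]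
  have hcont : ContinuousOn (Psi N s) (Set.Icc 0 (((N : ℝ) - 2 * s) / 2)) := by
    have h : ContinuousOn (fun α : ℝ =>
        (2 : ℝ) ^ (2 * s) * (gq s (α / 2) * gq s (((N : ℝ) - α - 2 * s) / 2)))
        (Set.Icc 0 (((N : ℝ) - 2 * s) / 2)) := by
      refine continuousOn_const.mul (ContinuousOn.mul ?_ ?_)
      · refine (gq_cont hs).comp (f := fun α : ℝ => α / 2) (by fun_prop) ?_
        intro a ha
        exact div_nonneg ha.1 (by norm_num)
      · refine (gq_cont hs).comp (f := fun α : ℝ => ((N : ℝ) - α - 2 * s) / 2) (by fun_prop) ?_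
        intro a ha
        have h3 := ha.2
        show (0 : ℝ) ≤ ((N : ℝ) - a - 2 * s) / 2
        linarith
    exact h.congr fun x _ => Psi_eq N s x
  have hsurj : Set.SurjOn (Psi N s) (Set.Icc 0 (((N : ℝ) - 2 * s) / 2))
      (Set.Icc 0 (Lam N s)) := by
    have := intermediate_value_Icc hc.le hcont
    rwa [h0, hL] at this
  have hl : (0 : ℝ) ∈ Set.Icc 0 (((N : ℝ) - 2 * s) / 2) := ⟨le_rfl, hc.le⟩
  have hr : ((N : ℝ) - 2 * s) / 2 ∈ Set.Icc 0 (((N : ℝ) - 2 * s) / 2) := ⟨hc.le, le_rfl⟩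
  refine ⟨?_, hmono, hsurj, ?_⟩
  · intro a ha
    constructor
    · rw [← h0]; exact hmono.monotoneOn hl ha ha.1
    · rw [← hL]; exact hmono.monotoneOn ha hr ha.2
  · intro θ hθ hθ'
    obtain ⟨a, ha, rfl⟩ := hsurj ⟨hθ.le, hθ'.le⟩
    refine ⟨a, ⟨⟨lt_of_le_of_ne ha.1 ?_, lt_of_le_of_ne ha.2 ?_⟩, rfl⟩, ?_⟩
    · rintro rfl; rw [h0] at hθ; exact lt_irrefl _ hθ
    · rintro h; rw [h, hL] at hθ'; exact lt_irrefl _ hθ'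
    · rintro b ⟨hb, hab⟩
      exact hmono.injOn ⟨hb.1.le, hb.2.le⟩ ha hab
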